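/- For every angle θ with 0 < θ ≤ 0.0539·π, every action minimizer q of the action functional A over the admissible class P(Q_S, Q_{E₁}) is collision-free: for all t ∈ [0,1] and all indices i ≠ j one has qᵢ(t) ≠ qⱼ(t). -/

import Mathlib

open Real MeasureTheory Set
open scoped ENNReal

noncomputable section

/-- Euclidean norm on `ℝ × ℝ` (row vectors in the plane). -/
def enorm2 (v : ℝ × ℝ) : ℝ := Real.sqrt (v.1 ^ 2 + v.2 ^ 2)

/-- Row vector multiplied on the right by the rotation matrix `R θ`
with rows `(cos θ, sin θ)` and `(-sin θ, cos θ)`. -/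
def rotV (θ : ℝ) (v : ℝ × ℝ) : ℝ × ℝ :=
  (v.1 * Real.cos θ - v.2 * Real.sin θ, v.1 * Real.sin θ + v.2 * Real.cos θ)

/-- `H¹([0,1],(ℝ²)⁴)`: absolutely continuous paths `[0,1] → (ℝ²)⁴` with
square-integrable derivative, recorded via an integrable (a.e.-)derivative `v`
together with the integral representation of `q`. -/
structure H1Path4 where
  q : ℝ → Fin 4 → ℝ × ℝ
  v : ℝ → Fin 4 → ℝ × ℝ
  hvInt : ∀ i : Fin 4, IntegrableOn (fun t => v t i) (Icc (0:ℝ) 1)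
  hrep : ∀ i : Fin 4, ∀ t ∈ Icc (0:ℝ) 1, q t i = q 0 i + ∫ s in (0:ℝ)..t, v s i
  hL2 : ∀ i : Fin 4, IntegrableOn (fun t => enorm2 (v t i) ^ 2) (Icc (0:ℝ) 1)

/-- Center of mass at the origin throughout `[0,1]` (the path lies in `χ`). -/
def H1Path4.inChi (p : H1Path4) : Prop := ∀ t ∈ Icc (0:ℝ) 1, ∑ i, p.q t i = 0

/-- The Lagrangian action functional `A`, with value `+∞` allowed. -/
def action (p : H1Path4) : ℝ≥0∞ :=
  ∫⁻ t in Icc (0:ℝ) 1,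
    (ENNReal.ofReal ((1/2) * ∑ i, enorm2 (p.v t i) ^ 2)
      + ∑ i : Fin 4, ∑ j ∈ Finset.univ.filter (fun j => i < j),
          (ENNReal.ofReal (enorm2 (p.q t i - p.q t j)))⁻¹)

/-- The starting boundary configuration set `Q_S` (double isosceles with order
constraints). -/
def QSset : Set (Fin 4 → ℝ × ℝ) :=
  { c | ∃ a₁ b₁ c₁ : ℝ, 0 ≤ b₁ ∧ 0 ≤ c₁ ∧
      c = ![(-a₁ - c₁, 0), (-a₁, 0), ((2*a₁ + c₁)/2, b₁), ((2*a₁ + c₁)/2, -b₁)] }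

/-- The ending boundary configuration set `Q_{E₁}`. -/
def QE1set (θ : ℝ) : Set (Fin 4 → ℝ × ℝ) :=
  { c | ∃ a₂ b₂ c₂ : ℝ, 0 ≤ b₂ ∧ 0 ≤ c₂ ∧
      c = fun i => rotV θ (![(-b₂, -a₂), (-c₂, a₂), (c₂, a₂), (b₂, -a₂)] i) }

/-- The ending boundary configuration set `Q_{E₂}`. -/
def QE2set (θ : ℝ) : Set (Fin 4 → ℝ × ℝ) :=
  { c | ∃ a₂ b₂ c₂ : ℝ, 0 ≤ b₂ ∧ 0 ≤ c₂ ∧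
      c = fun i => rotV θ (![(-a₂, -b₂), (-a₂, b₂), (a₂, c₂), (a₂, -c₂)] i) }

/-- Membership in the admissible class `P(Q_S, E)`. -/
def inAdm (E : Set (Fin 4 → ℝ × ℝ)) (p : H1Path4) : Prop :=
  p.inChi ∧ p.q 0 ∈ QSset ∧ p.q 1 ∈ E

/-- `p` is an action minimizer over `P(Q_S, E)`. -/
def isMin (E : Set (Fin 4 → ℝ × ℝ)) (p : H1Path4) : Prop :=
  inAdm E p ∧ ∀ p' : H1Path4, inAdm E p' → action p ≤ action p'

/-- The Newtonian equations of the equal-mass four-body problem, on a set `s`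
of times. -/
def newton (Q : ℝ → Fin 4 → ℝ × ℝ) (s : Set ℝ) : Prop :=
  ∀ i : Fin 4, ∀ t ∈ s,
    deriv (deriv (fun u => Q u i)) t =
      ∑ j ∈ Finset.univ.erase i, (1 / enorm2 (Q t j - Q t i) ^ 3) • (Q t j - Q t i)

/-- `x` is an `H¹` function on `[0, 1]` with weak derivative `v`. -/
structure IsH1 (x v : ℝ → ℝ) : Prop where
  mem : MemLp v 2 (volume.restrict (Ioc (0:ℝ) 1))
  rep : ∀ t ∈ Icc (0:ℝ) 1, x t = x 0 + ∫ s in (0:ℝ)..t, v s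

namespace IsH1

variable {x y v w : ℝ → ℝ}

lemma intervalIntegrable (h : IsH1 x v) : IntervalIntegrable v volume 0 1 := by
  rw [intervalIntegrable_iff_integrableOn_Ioc_of_le zero_le_one]
  exact h.mem.integrable (by norm_num)

lemma intervalIntegrable_sq (h : IsH1 x v) :
    IntervalIntegrable (fun t => v t ^ 2) volume 0 1 := by
  rw [intervalIntegrable_iff_integrableOn_Ioc_of_le zero_le_one]
  exact h.mem.integrable_sq

lemma intervalIntegrable_of_mem (h : IsH1 x v) {a b : ℝ} (ha : a ∈ Icc (0:ℝ) 1)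
    (hb : b ∈ Icc (0:ℝ) 1) : IntervalIntegrable v volume a b :=
  h.intervalIntegrable.mono_set (by
    rw [uIcc_of_le zero_le_one]; exact uIcc_subset_Icc ha hb)

lemma intervalIntegrable_sq_of_mem (h : IsH1 x v) {a b : ℝ} (ha : a ∈ Icc (0:ℝ) 1)
    (hb : b ∈ Icc (0:ℝ) 1) : IntervalIntegrable (fun t => v t ^ 2) volume a b :=
  h.intervalIntegrable_sq.mono_set (by
    rw [uIcc_of_le zero_le_one]; exact uIcc_subset_Icc ha hb)

lemma add (hx : IsH1 x v) (hy : IsH1 y w) :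
    IsH1 (fun t => x t + y t) (fun t => v t + w t) where
  mem := hx.mem.add hy.mem
  rep t ht := by
    have h0 : (0:ℝ) ∈ Icc (0:ℝ) 1 := by simp
    rw [intervalIntegral.integral_add (hx.intervalIntegrable_of_mem h0 ht)
      (hy.intervalIntegrable_of_mem h0 ht), hx.rep t ht, hy.rep t ht]
    ring

lemma const_mul (c : ℝ) (hx : IsH1 x v) :
    IsH1 (fun t => c * x t) (fun t => c * v t) where
  mem := hx.mem.const_mul c
  rep t ht := by
    rw [intervalIntegral.integral_const_mul, hx.rep t ht]
    ring

lemma sub (hx : IsH1 x v) (hy : IsH1 y w) :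
    IsH1 (fun t => x t - y t) (fun t => v t - w t) := by
  simpa [sub_eq_add_neg] using hx.add (hy.const_mul (-1))

lemma absolutelyContinuous (h : IsH1 x v) : AbsolutelyContinuousOnInterval x 0 1 := by
  have h1 := h.intervalIntegrable.absolutelyContinuousOnInterval_intervalIntegral
    (c := 0) (by simp)
  rw [absolutelyContinuousOnInterval_iff] at h1 ⊢
  intro ε hε
  obtain ⟨δ, hδ, H⟩ := h1 ε hε
  refine ⟨δ, hδ, fun E hE hl => ?_⟩
  refine lt_of_eq_of_lt (Finset.sum_congr rfl fun i hi => ?_) (H E hE hl)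
  have h2 := hE.1 i hi
  rw [uIcc_of_le zero_le_one] at h2
  rw [h.rep _ h2.1, h.rep _ h2.2, dist_add_left]

lemma continuousOn (h : IsH1 x v) : ContinuousOn x (Icc 0 1) := by
  simpa using h.absolutelyContinuous.continuousOn

lemma ae_hasDerivAt (h : IsH1 x v) :
    ∀ᵐ t, t ∈ Ioo (0:ℝ) 1 → HasDerivAt x (v t) t := by
  filter_upwards [h.intervalIntegrable.ae_hasDerivAt_integral] with t ht hm
  rw [uIcc_of_le zero_le_one] at ht
  have h1 := (ht (Ioo_subset_Icc_self hm) 0 (by simp)).const_add (x 0)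
  refine h1.congr_of_eventuallyEq ?_
  filter_upwards [Ioo_mem_nhds hm.1 hm.2] with s hs
  exact h.rep s (Ioo_subset_Icc_self hs)

lemma sq_sub_le (h : IsH1 x v) {s t : ℝ} (hs : s ∈ Icc (0:ℝ) 1) (ht : t ∈ Icc (0:ℝ) 1) :
    (x t - x s) ^ 2 ≤ ∫ τ in (0:ℝ)..1, v τ ^ 2 := by
  wlog hst : s ≤ t generalizing s t
  · have := this ht hs (le_of_not_ge hst)
    nlinarith
  have h0 : (0:ℝ) ∈ Icc (0:ℝ) 1 := by simp
  have hm : x t - x s = ∫ τ in s..t, v τ := by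
    rw [h.rep t ht, h.rep s hs, add_sub_add_left_eq_sub,
      intervalIntegral.integral_interval_sub_left (h.intervalIntegrable_of_mem h0 ht)
        (h.intervalIntegrable_of_mem h0 hs)]
  set m := x t - x s
  have hi := h.intervalIntegrable_of_mem hs ht
  have hi2 := h.intervalIntegrable_sq_of_mem hs ht
  have h1 : 0 ≤ ∫ τ in s..t, (v τ - m) ^ 2 :=
    intervalIntegral.integral_nonneg hst fun _ _ => sq_nonneg _
  have h2 : (∫ τ in s..t, (v τ - m) ^ 2)
      = (∫ τ in s..t, v τ ^ 2) - 2 * m * m + (t - s) * m ^ 2 := by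
    have : ∀ τ, (v τ - m) ^ 2 = v τ ^ 2 - 2 * m * v τ + m ^ 2 := fun τ => by ring
    simp only [this]
    rw [intervalIntegral.integral_add (hi2.sub (hi.const_mul _)) (by simp),
      intervalIntegral.integral_sub hi2 (hi.const_mul _),
      intervalIntegral.integral_const_mul, intervalIntegral.integral_const, ← hm, smul_eq_mul]
  have h3 : (∫ τ in s..t, v τ ^ 2) ≤ ∫ τ in (0:ℝ)..1, v τ ^ 2 :=
    intervalIntegral.integral_mono_interval hs.1 hst ht.2
      (Filter.Eventually.of_forall fun _ => sq_nonneg _) h.intervalIntegrable_sq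
  have h4 : t - s ≤ 1 := by linarith [hs.1, ht.2]
  nlinarith [sq_nonneg m]

end IsH1

lemma AbsolutelyContinuousOnInterval.of_dist_le {f g h : ℝ → ℝ} {a b : ℝ}
    (hg : AbsolutelyContinuousOnInterval g a b) (hh : AbsolutelyContinuousOnInterval h a b)
    (H : ∀ s ∈ uIcc a b, ∀ t ∈ uIcc a b, dist (f s) (f t) ≤ dist (g s) (g t) + dist (h s) (h t)) :
    AbsolutelyContinuousOnInterval f a b := by
  rw [absolutelyContinuousOnInterval_iff] at hg hh ⊢
  intro ε hε
  obtain ⟨δ₁, hδ₁, H₁⟩ := hg (ε / 2) (by positivity)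
  obtain ⟨δ₂, hδ₂, H₂⟩ := hh (ε / 2) (by positivity)
  refine ⟨min δ₁ δ₂, lt_min hδ₁ hδ₂, fun E hE hl => ?_⟩
  have h1 := H₁ E hE (hl.trans_le (min_le_left _ _))
  have h2 := H₂ E hE (hl.trans_le (min_le_right _ _))
  have h3 := Finset.sum_le_sum fun i hi => H _ (hE.1 i hi).1 _ (hE.1 i hi).2
  rw [Finset.sum_add_distrib] at h3
  linarith

lemma AbsolutelyContinuousOnInterval.of_hasDerivAt {f f' : ℝ → ℝ} {a b : ℝ}
    (hf : ∀ t ∈ uIcc a b, HasDerivAt f (f' t) t) (hc : ContinuousOn f' (uIcc a b)) :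
    AbsolutelyContinuousOnInterval f a b := by
  obtain ⟨C, hC⟩ := isCompact_uIcc.exists_bound_of_continuousOn hc
  have : LipschitzOnWith (Real.toNNReal C) f (uIcc a b) := by
    refine (convex_uIcc a b).lipschitzOnWith_of_nnnorm_hasDerivWithin_le
      (fun t ht => (hf t ht).hasDerivWithinAt) fun t ht => ?_
    rw [← NNReal.coe_le_coe, coe_nnnorm]
    exact (hC t ht).trans (Real.le_coe_toNNReal C)
  exact this.absolutelyContinuousOnInterval

/-- One-sided fundamental theorem of calculus for absolutely continuous functions. -/
lemma AbsolutelyContinuousOnInterval.sub_le_integral {G F : ℝ → ℝ} {a b : ℝ} (hab : a ≤ b)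
    (hG : AbsolutelyContinuousOnInterval G a b) (hF : IntervalIntegrable F volume a b)
    (H : ∀ᵐ t, t ∈ Ioo a b → ∃ g, HasDerivAt G g t ∧ g ≤ F t) :
    G b - G a ≤ ∫ t in a..b, F t := by
  rw [← hG.integral_deriv_eq_sub]
  refine intervalIntegral.integral_mono_ae_restrict hab hG.intervalIntegrable_deriv hF ?_
  rw [← Measure.restrict_congr_set Ioo_ae_eq_Icc]
  rw [Filter.EventuallyLE, ae_restrict_iff' measurableSet_Ioo]
  filter_upwards [H] with t ht hm
  obtain ⟨g, h1, h2⟩ := ht hm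
  rwa [h1.deriv]

/-- Riccati calibration of the quadratic functional `∫ v² - ω² g²`. -/
lemma IsH1.riccati_bound {g v M : ℝ → ℝ} (h : IsH1 g v) (ω : ℝ)
    (hM : ∀ t ∈ Icc (0:ℝ) 1, HasDerivAt M (-M t ^ 2 - ω ^ 2) t) :
    M 1 * g 1 ^ 2 - M 0 * g 0 ^ 2 ≤ ∫ t in (0:ℝ)..1, (v t ^ 2 - ω ^ 2 * g t ^ 2) := by
  have hMc : ContinuousOn M (Icc 0 1) := fun t ht => (hM t ht).continuousAt.continuousWithinAt
  have hac : AbsolutelyContinuousOnInterval (fun t => M t * g t ^ 2) 0 1 := by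
    have h1 : AbsolutelyContinuousOnInterval M 0 1 := by
      refine .of_hasDerivAt (f' := fun t => -M t ^ 2 - ω ^ 2) (by simpa using hM) ?_
      rw [uIcc_of_le zero_le_one]
      fun_prop
    have h2 := h.absolutelyContinuous
    have h3 := h1.mul (h2.mul h2)
    convert h3 using 2
    simp [sq]
  refine hac.sub_le_integral zero_le_one ?_ ?_
  · refine h.intervalIntegrable_sq.sub (ContinuousOn.intervalIntegrable ?_)
    rw [uIcc_of_le zero_le_one]
    have := h.continuousOn
    fun_prop
  · filter_upwards [h.ae_hasDerivAt] with t ht hm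
    refine ⟨_, (hM t (Ioo_subset_Icc_self hm)).mul ((ht hm).pow 2), ?_⟩
    simp only [Nat.cast_ofNat, Nat.add_one_sub_one, pow_one]
    nlinarith [sq_nonneg (v t - M t * g t)]

/-- Quadratic functional of a planar path, in coordinates `(u, w)` adapted to a line (`w = 0`) on
which the path ends. -/
lemma IsH1.rotation_bound {u w u' w' : ℝ → ℝ} (hu : IsH1 u u') (hw : IsH1 w w') {θ : ℝ}
    (h0 : 0 < θ) (h1 : θ < π / 2) (hend : w 1 = 0) :
    θ * (cos θ / sin θ * w 0 ^ 2 - sin θ / cos θ * u 0 ^ 2) ≤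
      (∫ t in (0:ℝ)..1, (u' t ^ 2 - θ ^ 2 * u t ^ 2)) +
        ∫ t in (0:ℝ)..1, (w' t ^ 2 - θ ^ 2 * w t ^ 2) := by
  have hU : -(θ * (sin θ / cos θ) * u 0 ^ 2) ≤
      ∫ t in (0:ℝ)..1, (u' t ^ 2 - θ ^ 2 * u t ^ 2) := by
    have := hu.riccati_bound (M := fun t => θ * (sin (θ * (1 - t)) / cos (θ * (1 - t)))) θ ?_
    · simpa using this
    · intro t ht
      have hc : cos (θ * (1 - t)) ≠ 0 := by
        refine (cos_pos_of_mem_Ioo ⟨?_, ?_⟩).ne'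
        · have : 0 ≤ θ * (1 - t) := mul_nonneg h0.le (by linarith [ht.2])
          linarith [pi_pos]
        · nlinarith [ht.1]
      have hl : HasDerivAt (fun t : ℝ => θ * (1 - t)) (-θ) t := by
        simpa using ((hasDerivAt_id t).const_sub 1).const_mul θ
      convert! ((hl.sin.div hl.cos hc).const_mul θ) using 1
      field_simp
      ring
  have hW : ∀ δ ∈ Ioo 0 (π / 2 - θ), θ * (cos (θ + δ) / sin (θ + δ)) * w 0 ^ 2 ≤
      ∫ t in (0:ℝ)..1, (w' t ^ 2 - θ ^ 2 * w t ^ 2) := by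
    intro δ hδ
    have := hw.riccati_bound
      (M := fun t => -(θ * (cos (θ * (1 - t) + δ) / sin (θ * (1 - t) + δ)))) θ ?_
    · simpa [hend] using this
    · intro t ht
      have hs : sin (θ * (1 - t) + δ) ≠ 0 := by
        have : 0 ≤ θ * (1 - t) := mul_nonneg h0.le (by linarith [ht.2])
        refine (sin_pos_of_pos_of_lt_pi ?_ ?_).ne'
        · linarith [hδ.1]
        · nlinarith [ht.1, hδ.2, pi_pos]
      have hl : HasDerivAt (fun t : ℝ => θ * (1 - t) + δ) (-θ) t := by
        simpa using (((hasDerivAt_id t).const_sub 1).const_mul θ).add_const δ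
      convert! ((hl.cos.div hl.sin hs).const_mul θ).neg using 1
      field_simp
      ring
  have hlim : θ * (cos θ / sin θ) * w 0 ^ 2 ≤
      ∫ t in (0:ℝ)..1, (w' t ^ 2 - θ ^ 2 * w t ^ 2) := by
    have hs : sin θ ≠ 0 := (sin_pos_of_pos_of_lt_pi h0 (by linarith [pi_pos])).ne'
    have hcont : ContinuousAt (fun δ : ℝ => θ * (cos (θ + δ) / sin (θ + δ)) * w 0 ^ 2) 0 := by
      have : sin (θ + 0) ≠ 0 := by simpa using hs
      fun_prop (disch := assumption)
    have ht := hcont.tendsto.mono_left (nhdsWithin_le_nhds (s := Ioi 0))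
    simp only [add_zero] at ht
    refine le_of_tendsto ht ?_
    filter_upwards [Ioo_mem_nhdsGT (show (0:ℝ) < π / 2 - θ by linarith)] with δ hδ
    exact hW δ hδ
  linarith

lemma sqrt_add_sq_sub_le (x₁ y₁ x₂ y₂ e : ℝ) :
    √(x₁ ^ 2 + y₁ ^ 2 + e ^ 2) - √(x₂ ^ 2 + y₂ ^ 2 + e ^ 2) ≤ |x₁ - x₂| + |y₁ - y₂| := by
  set B := x₂ ^ 2 + y₂ ^ 2 + e ^ 2 with hB
  have hB0 : 0 ≤ B := by positivity
  have hx : |x₂| ≤ √B := Real.abs_le_sqrt (by rw [hB]; nlinarith [sq_nonneg y₂, sq_nonneg e])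
  have hy : |y₂| ≤ √B := Real.abs_le_sqrt (by rw [hB]; nlinarith [sq_nonneg x₂, sq_nonneg e])
  rw [sub_le_iff_le_add']
  apply Real.sqrt_le_iff.2
  refine ⟨by positivity, ?_⟩
  have h1 : x₂ * (x₁ - x₂) ≤ √B * |x₁ - x₂| :=
    (le_abs_self _).trans (by rw [abs_mul]; gcongr)
  have h2 : y₂ * (y₁ - y₂) ≤ √B * |y₁ - y₂| :=
    (le_abs_self _).trans (by rw [abs_mul]; gcongr)
  have h3 := Real.sq_sqrt hB0
  nlinarith [sq_abs (x₁ - x₂), sq_abs (y₁ - y₂),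
    mul_nonneg (abs_nonneg (x₁ - x₂)) (abs_nonneg (y₁ - y₂))]

/-- Calibration of the regularised Kepler action in Levi-Civita time `s`. -/
lemma IsH1.levi_civita_bound {x y vx vy P s : ℝ → ℝ} (hx : IsH1 x vx) (hy : IsH1 y vy)
    {e κ a b : ℝ} (he : 0 < e) (ha : 0 ≤ a) (hab : a ≤ b) (hb : b ≤ 1) (hPc : Continuous P)
    (hP0 : ∀ t, 0 < P t)
    (hP : ∀ t ∈ Icc (0:ℝ) 1, P t = √(x t ^ 2 + y t ^ 2 + e ^ 2))
    (hs : ∀ t, HasDerivAt s (1 / P t) t) (hsin : ∀ t ∈ Icc a b, sin (κ * s t) ≠ 0) :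
    κ ^ 2 * (b - a) + (κ * (cos (κ * s b) / sin (κ * s b)) * P b
        - κ * (cos (κ * s a) / sin (κ * s a)) * P a) ≤
      ∫ t in a..b, (1 / 4) * (vx t ^ 2 + vy t ^ 2) := by
  have haI : a ∈ Icc (0:ℝ) 1 := ⟨ha, hab.trans hb⟩
  have hbI : b ∈ Icc (0:ℝ) 1 := ⟨ha.trans hab, hb⟩
  have hsub : uIcc a b ⊆ uIcc 0 1 := by
    rw [uIcc_of_le zero_le_one]; exact uIcc_subset_Icc haI hbI
  set C : ℝ → ℝ := fun t => κ * (cos (κ * s t) / sin (κ * s t)) with hC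
  have hCd : ∀ t ∈ Icc a b, HasDerivAt C (-(κ ^ 2 + C t ^ 2) / P t) t := by
    intro t ht
    have h0 := hsin t ht
    have h1 := (hP0 t).ne'
    have hl := (hs t).const_mul κ
    convert! ((hl.cos.div hl.sin h0).const_mul κ) using 1
    simp only [hC]
    field_simp
    ring
  have hCc : ContinuousOn C (Icc a b) := fun t ht => (hCd t ht).continuousAt.continuousWithinAt
  have hCac : AbsolutelyContinuousOnInterval C a b := by
    refine .of_hasDerivAt (f' := fun t => -(κ ^ 2 + C t ^ 2) / P t) (by rwa [uIcc_of_le hab]) ?_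
    rw [uIcc_of_le hab]
    exact ContinuousOn.div (by fun_prop) hPc.continuousOn fun t _ => (hP0 t).ne'
  have hPac : AbsolutelyContinuousOnInterval P a b := by
    refine .of_dist_le (hx.absolutelyContinuous.mono hsub) (hy.absolutelyContinuous.mono hsub) ?_
    intro p hp q hq
    have hp' := hsub hp
    have hq' := hsub hq
    rw [uIcc_of_le zero_le_one] at hp' hq'
    rw [hP p hp', hP q hq', Real.dist_eq, Real.dist_eq, Real.dist_eq, abs_le]
    constructor
    · have := sqrt_add_sq_sub_le (x q) (y q) (x p) (y p) e
      rw [abs_sub_comm (x p), abs_sub_comm (y p)]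
      linarith
    · exact sqrt_add_sq_sub_le (x p) (y p) (x q) (y q) e
  have hvx := hx.intervalIntegrable_sq_of_mem haI hbI
  have hvy := hy.intervalIntegrable_sq_of_mem haI hbI
  have key : C b * P b - C a * P a ≤
      ∫ t in a..b, ((1 / 4) * (vx t ^ 2 + vy t ^ 2) - κ ^ 2) := by
    refine (hCac.mul hPac).sub_le_integral hab (((hvx.add hvy).const_mul _).sub (by simp)) ?_
    filter_upwards [hx.ae_hasDerivAt, hy.ae_hasDerivAt] with t h1 h2 hm
    have hm' : t ∈ Ioo (0:ℝ) 1 := ⟨ha.trans_lt hm.1, hm.2.trans_le hb⟩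
    specialize h1 hm'
    specialize h2 hm'
    have hpos : 0 < x t ^ 2 + y t ^ 2 + e ^ 2 := by positivity
    have hd : HasDerivAt P ((x t * vx t + y t * vy t) / P t) t := by
      have h3 := (((h1.pow 2).add (h2.pow 2)).add_const (e ^ 2)).sqrt hpos.ne'
      have h4 : HasDerivAt (fun t => √(x t ^ 2 + y t ^ 2 + e ^ 2))
          ((x t * vx t + y t * vy t) / P t) t := by
        convert! h3 using 1
        rw [hP t (Ioo_subset_Icc_self hm')]
        simp
        field_simp
      refine h4.congr_of_eventuallyEq ?_
      filter_upwards [Ioo_mem_nhds hm'.1 hm'.2] with τ hτ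
      exact hP τ (Ioo_subset_Icc_self hτ)
    refine ⟨_, (hCd t (Ioo_subset_Icc_self hm)).mul hd, ?_⟩
    set D := (x t * vx t + y t * vy t) / P t with hD
    have hD2 : D ^ 2 ≤ vx t ^ 2 + vy t ^ 2 := by
      rw [hD, div_pow, div_le_iff₀ (by have := hP0 t; positivity)]
      rw [hP t (Ioo_subset_Icc_self hm'), Real.sq_sqrt hpos.le]
      nlinarith [sq_nonneg (x t * vy t - y t * vx t), sq_nonneg (e * vx t), sq_nonneg (e * vy t)]
    have h5 : -(κ ^ 2 + C t ^ 2) / P t * P t = -(κ ^ 2 + C t ^ 2) :=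
      div_mul_cancel₀ _ (hP0 t).ne'
    rw [h5]
    nlinarith [sq_nonneg (D / 2 - C t)]
  rw [intervalIntegral.integral_sub ((hvx.add hvy).const_mul _) (by simp),
    intervalIntegral.integral_const, smul_eq_mul] at key
  linarith

lemma mul_cot_le_inv {κ δ : ℝ} (hκ : 0 < κ) (hδ : 0 < δ) (h : κ * δ < π / 2) :
    κ * (cos (κ * δ) / sin (κ * δ)) ≤ 1 / δ := by
  have hz : 0 < κ * δ := by positivity
  have hs : 0 < sin (κ * δ) := sin_pos_of_pos_of_lt_pi hz (by linarith [pi_pos])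
  have hc : 0 < cos (κ * δ) := cos_pos_of_mem_Ioo ⟨by linarith [pi_pos], h⟩
  have ht := Real.lt_tan hz h
  rw [Real.tan_eq_sin_div_cos, lt_div_iff₀ hc] at ht
  rw [← mul_div_assoc, div_le_div_iff₀ hs hδ]
  linarith

/-- Lower bound for the regularised Kepler action of a path through the origin. -/
lemma IsH1.collision_bound {x y vx vy : ℝ → ℝ} (hx : IsH1 x vx) (hy : IsH1 y vy)
    {t₀ : ℝ} (ht₀ : t₀ ∈ Icc (0:ℝ) 1) (hx0 : x t₀ = 0) (hy0 : y t₀ = 0) :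
    2.4 ≤ 0.23 * ((∫ t in (0:ℝ)..1, vx t ^ 2) + ∫ t in (0:ℝ)..1, vy t ^ 2) +
      ∫ t in (0:ℝ)..1, (√(x t ^ 2 + y t ^ 2 + 0.0001 ^ 2))⁻¹ := by
  set f : Icc (0:ℝ) 1 → ℝ := fun t => √(x t ^ 2 + y t ^ 2 + 0.0001 ^ 2) with hf
  have hfc : Continuous f := by
    have h1 := continuousOn_iff_continuous_domRestrict.1 hx.continuousOn
    have h2 := continuousOn_iff_continuous_domRestrict.1 hy.continuousOn
    exact ((h1.pow 2).add (h2.pow 2)).add_const _ |>.sqrt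
  set P : ℝ → ℝ := IccExtend zero_le_one f with hPdef
  have hPc : Continuous P := hfc.Icc_extend'
  have hP0 : ∀ t, 0 < P t := fun t => Real.sqrt_pos.2 (by positivity)
  have hP : ∀ t ∈ Icc (0:ℝ) 1, P t = √(x t ^ 2 + y t ^ 2 + 0.0001 ^ 2) := fun t ht => by
    rw [hPdef, IccExtend_of_mem _ _ ht]
  have hPt₀ : P t₀ = 0.0001 := by
    rw [hP t₀ ht₀, hx0, hy0]
    simp
    norm_num
  have hic : Continuous fun t => 1 / P t := continuous_const.div hPc fun t => (hP0 t).ne'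
  have hii : ∀ a b, IntervalIntegrable (fun t => 1 / P t) volume a b :=
    fun a b => hic.intervalIntegrable a b
  set S : ℝ := ∫ t in (0:ℝ)..1, 1 / P t with hS
  have hSint : ∫ t in (0:ℝ)..1, (√(x t ^ 2 + y t ^ 2 + 0.0001 ^ 2))⁻¹ = S := by
    refine intervalIntegral.integral_congr fun t ht => ?_
    rw [uIcc_of_le zero_le_one] at ht
    simp only [hP t ht, one_div]
  have hSpos : 0 < S := intervalIntegral.intervalIntegral_pos_of_pos (hii 0 1)
    (fun t => by have := hP0 t; positivity) zero_lt_one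
  have hSle : ∀ a b, 0 ≤ a → a ≤ b → b ≤ 1 → ∫ t in a..b, 1 / P t ≤ S := fun a b ha hab hb =>
    intervalIntegral.integral_mono_interval ha hab hb
      (Filter.Eventually.of_forall fun t => by have := hP0 t; simp; positivity) (hii 0 1)
  have hnn : ∀ a b, a ≤ b → 0 ≤ ∫ t in a..b, 1 / P t := fun a b hab =>
    intervalIntegral.integral_nonneg hab fun t _ => by have := hP0 t; positivity
  set κ : ℝ := π / (2 * (S + 0.01)) with hκ
  have hκ0 : 0 < κ := by positivity
  have hκS : κ * (S + 0.01) = π / 2 := by rw [hκ]; field_simp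
  have hcot := mul_cot_le_inv hκ0 (show (0:ℝ) < 0.01 by norm_num) (by nlinarith)
  have hderiv : ∀ c t, HasDerivAt (fun t => c + ∫ τ in t₀..t, 1 / P τ) (1 / P t) t := fun c t =>
    (hic.integral_hasStrictDerivAt t₀ t).hasDerivAt.const_add c
  have hR : κ ^ 2 * (1 - t₀) - 0.01 ≤
      ∫ t in t₀..1, (1 / 4) * (vx t ^ 2 + vy t ^ 2) := by
    have hrange : ∀ t ∈ Icc t₀ 1, 0 < κ * (0.01 + ∫ τ in t₀..t, 1 / P τ) ∧
        κ * (0.01 + ∫ τ in t₀..t, 1 / P τ) ≤ π / 2 := by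
      intro t ht
      have h1 := hnn t₀ t ht.1
      have h2 := hSle t₀ t ht₀.1 ht.1 ht.2
      refine ⟨mul_pos hκ0 (by linarith), ?_⟩
      rw [← hκS]
      exact mul_le_mul_of_nonneg_left (by linarith) hκ0.le
    have h := hx.levi_civita_bound hy (κ := κ) (by norm_num) ht₀.1 ht₀.2 le_rfl hPc hP0 hP
      (hderiv 0.01) (fun t ht => (sin_pos_of_pos_of_lt_pi (hrange t ht).1
        (by linarith [(hrange t ht).2, pi_pos])).ne')
    have h1 := hrange 1 ⟨ht₀.2, le_rfl⟩
    have hG : 0 ≤ κ * (cos (κ * (0.01 + ∫ τ in t₀..1, 1 / P τ)) /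
        sin (κ * (0.01 + ∫ τ in t₀..1, 1 / P τ))) * P 1 := by
      have := cos_nonneg_of_mem_Icc (x := κ * (0.01 + ∫ τ in t₀..1, 1 / P τ))
        ⟨by linarith [pi_pos], h1.2⟩
      have := sin_nonneg_of_nonneg_of_le_pi h1.1.le (by linarith [pi_pos])
      have := (hP0 1).le
      positivity
    rw [hPt₀, intervalIntegral.integral_same, add_zero] at h
    linarith
  have hL : κ ^ 2 * t₀ - 0.01 ≤ ∫ t in (0:ℝ)..t₀, (1 / 4) * (vx t ^ 2 + vy t ^ 2) := by
    have hrange : ∀ t ∈ Icc 0 t₀, κ * (-0.01 + ∫ τ in t₀..t, 1 / P τ) < 0 ∧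
        -(π / 2) ≤ κ * (-0.01 + ∫ τ in t₀..t, 1 / P τ) := by
      intro t ht
      have h1 := hnn t t₀ ht.2
      have h2 := hSle t t₀ ht.1 ht.2 ht₀.2
      rw [intervalIntegral.integral_symm]
      refine ⟨mul_neg_of_pos_of_neg hκ0 (by linarith), ?_⟩
      rw [← hκS]
      nlinarith
    have h := hx.levi_civita_bound hy (κ := κ) (by norm_num) le_rfl ht₀.1 ht₀.2 hPc hP0 hP
      (hderiv (-0.01)) (fun t ht => (sin_neg_of_neg_of_neg_pi_lt (hrange t ht).1
        (by linarith [(hrange t ht).2, pi_pos])).ne)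
    have h1 := hrange 0 ⟨le_rfl, ht₀.1⟩
    have hG : κ * (cos (κ * (-0.01 + ∫ τ in t₀..0, 1 / P τ)) /
        sin (κ * (-0.01 + ∫ τ in t₀..0, 1 / P τ))) * P 0 ≤ 0 := by
      have h2 := cos_nonneg_of_mem_Icc (x := κ * (-0.01 + ∫ τ in t₀..0, 1 / P τ))
        ⟨h1.2, by linarith [pi_pos]⟩
      have h3 := sin_nonpos_of_nonpos_of_neg_pi_le h1.1.le (by linarith [pi_pos])
      exact mul_nonpos_of_nonpos_of_nonneg
        (mul_nonpos_of_nonneg_of_nonpos hκ0.le (div_nonpos_of_nonneg_of_nonpos h2 h3)) (hP0 0).le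
    rw [hPt₀, intervalIntegral.integral_same, add_zero, mul_neg, cos_neg, sin_neg, div_neg] at h
    linarith
  have h0I : (0:ℝ) ∈ Icc (0:ℝ) 1 := by simp
  have h1I : (1:ℝ) ∈ Icc (0:ℝ) 1 := by simp
  have hsum : (∫ t in (0:ℝ)..t₀, (1 / 4) * (vx t ^ 2 + vy t ^ 2)) +
      (∫ t in t₀..1, (1 / 4) * (vx t ^ 2 + vy t ^ 2)) =
      (1 / 4) * ((∫ t in (0:ℝ)..1, vx t ^ 2) + ∫ t in (0:ℝ)..1, vy t ^ 2) := by
    rw [intervalIntegral.integral_add_adjacent_intervals, intervalIntegral.integral_const_mul,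
      intervalIntegral.integral_add hx.intervalIntegrable_sq hy.intervalIntegrable_sq]
    · exact ((hx.intervalIntegrable_sq_of_mem h0I ht₀).add
        (hy.intervalIntegrable_sq_of_mem h0I ht₀)).const_mul _
    · exact ((hx.intervalIntegrable_sq_of_mem ht₀ h1I).add
        (hy.intervalIntegrable_sq_of_mem ht₀ h1I)).const_mul _
  rw [hSint]
  have hfin : 2.43 ≤ 0.92 * κ ^ 2 + (S + 0.01) := by
    set T := S + 0.01 with hT
    have hT0 : 0 < T := by positivity
    have h1 : 0.92 * κ ^ 2 + T = (0.23 * π ^ 2 + T ^ 3) / T ^ 2 := by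
      rw [hκ]; field_simp; ring
    rw [h1, le_div_iff₀ (by positivity)]
    have h2 : 3.14 ^ 2 ≤ π ^ 2 := by gcongr; exact Real.pi_gt_d2.le
    have h3 : 0 ≤ (T - 1.62) ^ 2 * (T + 0.81) := by positivity
    nlinarith
  linarith

lemma H1Path4.isH1_fst (p : H1Path4) (i : Fin 4) :
    IsH1 (fun t => (p.q t i).1) (fun t => (p.v t i).1) where
  mem := by
    have h := (p.hvInt i).mono_set Ioc_subset_Icc_self
    have hm : AEStronglyMeasurable (fun t => (p.v t i).1) (volume.restrict (Ioc (0:ℝ) 1)) :=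
      h.fst.aestronglyMeasurable
    refine (memLp_two_iff_integrable_sq hm).2 ?_
    refine Integrable.mono ((p.hL2 i).mono_set Ioc_subset_Icc_self) (hm.pow 2)
      (ae_of_all _ fun t => ?_)
    rw [enorm2, Real.sq_sqrt (by positivity), Real.norm_of_nonneg (by positivity),
      Real.norm_of_nonneg (by positivity)]
    nlinarith [sq_nonneg (p.v t i).2]
  rep t ht := by
    have h : IntervalIntegrable (fun s => p.v s i) volume 0 t := by
      rw [intervalIntegrable_iff_integrableOn_Icc_of_le ht.1]
      exact (p.hvInt i).mono_set (Icc_subset_Icc_right ht.2)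
    rw [p.hrep i t ht, Prod.fst_add]
    congr 1
    exact ((ContinuousLinearMap.fst ℝ ℝ ℝ).intervalIntegral_comp_comm h).symm

lemma H1Path4.isH1_snd (p : H1Path4) (i : Fin 4) :
    IsH1 (fun t => (p.q t i).2) (fun t => (p.v t i).2) where
  mem := by
    have h := (p.hvInt i).mono_set Ioc_subset_Icc_self
    have hm : AEStronglyMeasurable (fun t => (p.v t i).2) (volume.restrict (Ioc (0:ℝ) 1)) :=
      h.snd.aestronglyMeasurable
    refine (memLp_two_iff_integrable_sq hm).2 ?_
    refine Integrable.mono ((p.hL2 i).mono_set Ioc_subset_Icc_self) (hm.pow 2)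
      (ae_of_all _ fun t => ?_)
    rw [enorm2, Real.sq_sqrt (by positivity), Real.norm_of_nonneg (by positivity),
      Real.norm_of_nonneg (by positivity)]
    nlinarith [sq_nonneg (p.v t i).1]
  rep t ht := by
    have h : IntervalIntegrable (fun s => p.v s i) volume 0 t := by
      rw [intervalIntegrable_iff_integrableOn_Icc_of_le ht.1]
      exact (p.hvInt i).mono_set (Icc_subset_Icc_right ht.2)
    rw [p.hrep i t ht, Prod.snd_add]
    congr 1
    exact ((ContinuousLinearMap.snd ℝ ℝ ℝ).intervalIntegral_comp_comm h).symm

lemma IsH1.intervalIntegrable_lagrangian {x v : ℝ → ℝ} (h : IsH1 x v) (ω : ℝ) :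
    IntervalIntegrable (fun t => v t ^ 2 - ω ^ 2 * x t ^ 2) volume 0 1 := by
  refine h.intervalIntegrable_sq.sub (ContinuousOn.intervalIntegrable ?_)
  rw [uIcc_of_le zero_le_one]
  exact (h.continuousOn.pow 2).const_mul _

/-- Rotating both coordinates preserves the quadratic action. -/
lemma IsH1.lagrangian_rotate {x y vx vy : ℝ → ℝ} (hx : IsH1 x vx) (hy : IsH1 y vy)
    {c s : ℝ} (hcs : s ^ 2 + c ^ 2 = 1) (ω : ℝ) :
    (∫ t in (0:ℝ)..1, ((c * vx t + s * vy t) ^ 2 - ω ^ 2 * (c * x t + s * y t) ^ 2)) +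
      (∫ t in (0:ℝ)..1, ((c * vy t - s * vx t) ^ 2 - ω ^ 2 * (c * y t - s * x t) ^ 2)) =
    (∫ t in (0:ℝ)..1, (vx t ^ 2 - ω ^ 2 * x t ^ 2)) +
      ∫ t in (0:ℝ)..1, (vy t ^ 2 - ω ^ 2 * y t ^ 2) := by
  rw [← intervalIntegral.integral_add
      (((hx.const_mul c).add (hy.const_mul s)).intervalIntegrable_lagrangian ω)
      (((hy.const_mul c).sub (hx.const_mul s)).intervalIntegrable_lagrangian ω),
    ← intervalIntegral.integral_add (hx.intervalIntegrable_lagrangian ω)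
      (hy.intervalIntegrable_lagrangian ω)]
  refine intervalIntegral.integral_congr fun t _ => ?_
  linear_combination (vx t ^ 2 + vy t ^ 2 - ω ^ 2 * (x t ^ 2 + y t ^ 2)) * hcs

lemma one_le_mul_inv_sin_mul_cos {θ : ℝ} (h0 : 0 < θ) (h1 : θ < π / 2) :
    1 ≤ θ / (sin θ * cos θ) := by
  have hs : 0 < sin θ := sin_pos_of_pos_of_lt_pi h0 (by linarith)
  have hc : 0 < cos θ := cos_pos_of_mem_Ioo ⟨by linarith, h1⟩
  rw [le_div_iff₀ (by positivity)]
  nlinarith [sin_le h0.le, cos_le_one θ]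

/-- A path ending on the ray of angle `θ` and starting in the second or fourth closed quadrant
has nonnegative action for the Lagrangian `|v|² - θ²|x|²`. -/
lemma IsH1.lagrangian_nonneg {x y vx vy : ℝ → ℝ} (hx : IsH1 x vx) (hy : IsH1 y vy) {θ : ℝ}
    (h0 : 0 < θ) (h1 : θ ≤ 0.17) (hend : cos θ * y 1 - sin θ * x 1 = 0) (hq : x 0 * y 0 ≤ 0) :
    0 ≤ (∫ t in (0:ℝ)..1, (vx t ^ 2 - θ ^ 2 * x t ^ 2)) +
      ∫ t in (0:ℝ)..1, (vy t ^ 2 - θ ^ 2 * y t ^ 2) := by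
  have hπ : θ < π / 2 := by linarith [pi_gt_three]
  have hs : 0 < sin θ := sin_pos_of_pos_of_lt_pi h0 (by linarith [pi_gt_three])
  have hc : 0 < cos θ := cos_pos_of_mem_Ioo ⟨by linarith, hπ⟩
  have hcs := sin_sq_add_cos_sq θ
  have hsθ := sin_le h0.le
  rw [← hx.lagrangian_rotate hy hcs θ]
  refine le_trans ?_ (((hx.const_mul (cos θ)).add (hy.const_mul (sin θ))).rotation_bound
    ((hy.const_mul (cos θ)).sub (hx.const_mul (sin θ))) h0 hπ hend)
  have key : cos θ / sin θ * (cos θ * y 0 - sin θ * x 0) ^ 2 -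
      sin θ / cos θ * (cos θ * x 0 + sin θ * y 0) ^ 2 =
      (y 0 ^ 2 * (cos θ ^ 2 - sin θ ^ 2) - 2 * (x 0 * y 0) * (sin θ * cos θ)) *
        (sin θ ^ 2 + cos θ ^ 2) / (sin θ * cos θ) := by
    field_simp
    ring
  rw [key]
  have : 0 ≤ y 0 ^ 2 * (cos θ ^ 2 - sin θ ^ 2) := mul_nonneg (sq_nonneg _) (by nlinarith)
  have : 0 ≤ -(x 0 * y 0) * (sin θ * cos θ) := mul_nonneg (by linarith) (by positivity)
  rw [hcs]
  refine mul_nonneg h0.le (div_nonneg (by linarith) (by positivity))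

lemma IsH1.sq_le_lagrangian {x y vx vy : ℝ → ℝ} (hx : IsH1 x vx) (hy : IsH1 y vy) {θ : ℝ}
    (h0 : 0 < θ) (h1 : θ ≤ 0.17) (hend : cos θ * x 1 + sin θ * y 1 = 0) (hq : 0 ≤ x 0 * y 0) :
    0.8 * x 0 ^ 2 ≤ (∫ t in (0:ℝ)..1, (vx t ^ 2 - θ ^ 2 * x t ^ 2)) +
      ∫ t in (0:ℝ)..1, (vy t ^ 2 - θ ^ 2 * y t ^ 2) := by
  have hπ : θ < π / 2 := by linarith [pi_gt_three]
  have hs : 0 < sin θ := sin_pos_of_pos_of_lt_pi h0 (by linarith [pi_gt_three])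
  have hc : 0 < cos θ := cos_pos_of_mem_Ioo ⟨by linarith, hπ⟩
  have hcs := sin_sq_add_cos_sq θ
  have hsθ := sin_le h0.le
  rw [← hx.lagrangian_rotate hy hcs θ, add_comm]
  refine le_trans ?_ (((hy.const_mul (cos θ)).sub (hx.const_mul (sin θ))).rotation_bound
    ((hx.const_mul (cos θ)).add (hy.const_mul (sin θ))) h0 hπ hend)
  have key : θ * (cos θ / sin θ * (cos θ * x 0 + sin θ * y 0) ^ 2 -
      sin θ / cos θ * (cos θ * y 0 - sin θ * x 0) ^ 2) =
      (θ / (sin θ * cos θ)) * (x 0 ^ 2 * (cos θ ^ 2 - sin θ ^ 2) +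
        2 * (x 0 * y 0) * (sin θ * cos θ)) * (sin θ ^ 2 + cos θ ^ 2) := by
    field_simp
    ring
  rw [key, hcs, mul_one]
  have h2 : 0.8 * x 0 ^ 2 ≤ x 0 ^ 2 * (cos θ ^ 2 - sin θ ^ 2) := by
    rw [mul_comm]
    exact mul_le_mul_of_nonneg_left (by nlinarith) (sq_nonneg _)
  have h3 : 0 ≤ x 0 * y 0 * (sin θ * cos θ) := mul_nonneg hq (by positivity)
  nlinarith [one_le_mul_inv_sin_mul_cos h0 hπ, sq_nonneg (x 0)]

lemma ofReal_integral_le_lintegral {α : Type*} [MeasurableSpace α] {μ : Measure α} {f : α → ℝ}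
    (hf : Integrable f μ) : ENNReal.ofReal (∫ a, f a ∂μ) ≤ ∫⁻ a, ENNReal.ofReal (f a) ∂μ := by
  rw [integral_eq_lintegral_pos_part_sub_lintegral_neg_part hf]
  refine le_trans (ENNReal.ofReal_le_ofReal ?_) ENNReal.ofReal_toReal_le
  simp

lemma enorm2_nonneg (v : ℝ × ℝ) : 0 ≤ enorm2 v := Real.sqrt_nonneg _

lemma enorm2_sq (v : ℝ × ℝ) : enorm2 v ^ 2 = v.1 ^ 2 + v.2 ^ 2 :=
  Real.sq_sqrt (by positivity)

lemma enorm2_sub_comm (v w : ℝ × ℝ) : enorm2 (v - w) = enorm2 (w - v) := by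
  simp only [enorm2, Prod.fst_sub, Prod.snd_sub]
  congr 1
  ring

lemma ofReal_le_inv_ofReal {a d : ℝ} (h : 0 < d → a ≤ d⁻¹) :
    ENNReal.ofReal a ≤ (ENNReal.ofReal d)⁻¹ := by
  rcases le_or_gt d 0 with hd | hd
  · simp [ENNReal.ofReal_eq_zero.2 hd]
  · rw [← ENNReal.ofReal_inv_of_pos hd]
    exact ENNReal.ofReal_le_ofReal (h hd)

/-- The tangent-parabola bound for the Newtonian potential at distance `1 / ρ`. -/
lemma sub_le_inv_of_pos {ρ d : ℝ} (hρ : 0 < ρ) (hd : 0 < d) :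
    3 / 2 * ρ - ρ ^ 3 / 2 * d ^ 2 ≤ d⁻¹ := by
  rw [inv_eq_one_div, le_div_iff₀ hd]
  have hz : 0 < d * ρ := by positivity
  nlinarith [mul_nonneg (by linarith : 0 ≤ d * ρ + 2) (sq_nonneg (d * ρ - 1))]

/-- The action dominates the integral of any integrable function that is pointwise below the
regularized Lagrangian adapted to the splitting `{i, j}, {k, l}` of the four bodies. -/
lemma H1Path4.integral_le_action (p : H1Path4) {i j k l : Fin 4} {ρ : ℝ} (hρ : 0 < ρ)
    (hpair : ∀ f : Fin 4 → Fin 4 → ℝ≥0∞, (∀ a b, f a b = f b a) →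
      ∑ a : Fin 4, ∑ b ∈ Finset.univ.filter (fun b => a < b), f a b =
        f i j + (f k l + (f i k + (f i l + (f j k + f j l)))))
    (hsum : ∀ g : Fin 4 → ℝ, ∑ a, g a = g i + g j + g k + g l) {f : ℝ → ℝ}
    (hf : IntervalIntegrable f volume 0 1)
    (hle : ∀ t ∈ Icc (0:ℝ) 1, f t ≤
      1 / 2 * (enorm2 (p.v t i) ^ 2 + enorm2 (p.v t j) ^ 2 + enorm2 (p.v t k) ^ 2 +
        enorm2 (p.v t l) ^ 2) + (√(enorm2 (p.q t i - p.q t j) ^ 2 + 0.0001 ^ 2))⁻¹ + 6 * ρ -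
      ρ ^ 3 / 2 * (enorm2 (p.q t i - p.q t k) ^ 2 + enorm2 (p.q t i - p.q t l) ^ 2 +
        enorm2 (p.q t j - p.q t k) ^ 2 + enorm2 (p.q t j - p.q t l) ^ 2)) :
    ENNReal.ofReal (∫ t in (0:ℝ)..1, f t) ≤ action p := by
  rw [intervalIntegral.integral_of_le zero_le_one, ← integral_Icc_eq_integral_Ioc]
  rw [intervalIntegrable_iff_integrableOn_Icc_of_le zero_le_one] at hf
  refine (ofReal_integral_le_lintegral hf).trans (setLIntegral_mono' measurableSet_Icc ?_)
  intro t ht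
  rw [hpair (fun a b => (ENNReal.ofReal (enorm2 (p.q t a - p.q t b)))⁻¹)
    (fun a b => by rw [enorm2_sub_comm]), hsum]
  have hcross : ∀ a b, ENNReal.ofReal
      (3 / 2 * ρ - ρ ^ 3 / 2 * enorm2 (p.q t a - p.q t b) ^ 2) ≤
      (ENNReal.ofReal (enorm2 (p.q t a - p.q t b)))⁻¹ := fun a b =>
    ofReal_le_inv_ofReal fun hd => sub_le_inv_of_pos hρ hd
  have hij : ENNReal.ofReal (√(enorm2 (p.q t i - p.q t j) ^ 2 + 0.0001 ^ 2))⁻¹ ≤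
      (ENNReal.ofReal (enorm2 (p.q t i - p.q t j)))⁻¹ :=
    ofReal_le_inv_ofReal fun hd => inv_anti₀ hd (Real.le_sqrt_of_sq_le (by norm_num))
  have hfour := ENNReal.ofReal_add_le.trans <| add_le_add (hcross i k) <|
    ENNReal.ofReal_add_le.trans <| add_le_add (hcross i l) <|
    ENNReal.ofReal_add_le.trans <| add_le_add (hcross j k) (hcross j l)
  refine le_trans (ENNReal.ofReal_le_ofReal ((hle t ht).trans_eq ?_)) <|
    ENNReal.ofReal_add_le.trans <| add_le_add le_rfl <|
    ENNReal.ofReal_add_le.trans <| add_le_add hij <|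
    hfour.trans (le_add_of_nonneg_left zero_le)
  ring

lemma IsH1.sq_le_of_endpoint {x v : ℝ → ℝ} (h : IsH1 x v) {s t : ℝ} (hs : s ∈ Icc (0:ℝ) 1)
    (ht : t ∈ Icc (0:ℝ) 1) : x t ^ 2 ≤ 2 * (∫ τ in (0:ℝ)..1, v τ ^ 2) + 2 * x s ^ 2 := by
  nlinarith [h.sq_sub_le hs ht, sq_nonneg (x t - 2 * x s)]

lemma H1Path4.le_action_of_collision (p : H1Path4) {i j k l : Fin 4} {θ ρ c t₀ e : ℝ}
    (hρ : 0 < ρ) (hρθ : ρ ^ 3 = θ ^ 2 / 4) (h0 : 0 < θ) (h1 : θ ≤ 0.17)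
    (hpair : ∀ f : Fin 4 → Fin 4 → ℝ≥0∞, (∀ a b, f a b = f b a) →
      ∑ a : Fin 4, ∑ b ∈ Finset.univ.filter (fun b => a < b), f a b =
        f i j + (f k l + (f i k + (f i l + (f j k + f j l)))))
    (hsum : ∀ g : Fin 4 → ℝ, ∑ a, g a = g i + g j + g k + g l)
    (ht₀ : t₀ ∈ Icc (0:ℝ) 1) (hcol : p.q t₀ i = p.q t₀ j) (he : e ∈ Icc (0:ℝ) 1)
    (hend : enorm2 (p.q e k - p.q e l) ^ 2 ≤ 2 * enorm2 (p.q e i - p.q e j) ^ 2 + 2 * c ^ 2)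
    (hW : 0.2 * c ^ 2 ≤
      (∫ t in (0:ℝ)..1, ((1 / 2 * ((p.v t k).1 + (p.v t l).1 - ((p.v t i).1 + (p.v t j).1))) ^ 2 -
        θ ^ 2 * (1 / 2 * ((p.q t k).1 + (p.q t l).1 - ((p.q t i).1 + (p.q t j).1))) ^ 2)) +
      ∫ t in (0:ℝ)..1, ((1 / 2 * ((p.v t k).2 + (p.v t l).2 - ((p.v t i).2 + (p.v t j).2))) ^ 2 -
        θ ^ 2 * (1 / 2 * ((p.q t k).2 + (p.q t l).2 - ((p.q t i).2 + (p.q t j).2))) ^ 2)) :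
    ENNReal.ofReal (6 * ρ + 2.4) ≤ action p := by
  have hx1 := (p.isH1_fst i).sub (p.isH1_fst j)
  have hy1 := (p.isH1_snd i).sub (p.isH1_snd j)
  have hx2 := (p.isH1_fst k).sub (p.isH1_fst l)
  have hy2 := (p.isH1_snd k).sub (p.isH1_snd l)
  have hX := (((p.isH1_fst k).add (p.isH1_fst l)).sub
    ((p.isH1_fst i).add (p.isH1_fst j))).const_mul (1 / 2)
  have hY := (((p.isH1_snd k).add (p.isH1_snd l)).sub
    ((p.isH1_snd i).add (p.isH1_snd j))).const_mul (1 / 2)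
  have hcb := hx1.collision_bound hy1 ht₀ (by simp [hcol]) (by simp [hcol])
  have hinv : IntervalIntegrable (fun t => (√(((p.q t i).1 - (p.q t j).1) ^ 2 +
      ((p.q t i).2 - (p.q t j).2) ^ 2 + 0.0001 ^ 2))⁻¹) volume 0 1 := by
    refine ContinuousOn.intervalIntegrable ?_
    rw [uIcc_of_le zero_le_one]
    refine ContinuousOn.inv₀ (((hx1.continuousOn.pow 2).add (hy1.continuousOn.pow 2)).add
      continuousOn_const).sqrt fun t _ => ?_
    positivity
  have ix1 := hx1.intervalIntegrable_sq
  have iy1 := hy1.intervalIntegrable_sq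
  have ix2 := hx2.intervalIntegrable_sq
  have iy2 := hy2.intervalIntegrable_sq
  have iX := hX.intervalIntegrable_lagrangian θ
  have iY := hY.intervalIntegrable_lagrangian θ
  have bx1 : ∀ t ∈ Icc (0:ℝ) 1, _ := fun t ht => hx1.sq_sub_le ht₀ ht
  have by1 : ∀ t ∈ Icc (0:ℝ) 1, _ := fun t ht => hy1.sq_sub_le ht₀ ht
  have bx2 : ∀ t ∈ Icc (0:ℝ) 1, _ := fun t ht => hx2.sq_le_of_endpoint he ht
  have by2 : ∀ t ∈ Icc (0:ℝ) 1, _ := fun t ht => hy2.sq_le_of_endpoint he ht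
  simp only [hcol, sub_self, sub_zero] at bx1 by1
  simp only [enorm2_sq, Prod.fst_sub, Prod.snd_sub] at hend
  have hE2x : 0 ≤ ∫ t in (0:ℝ)..1, ((p.v t k).1 - (p.v t l).1) ^ 2 :=
    intervalIntegral.integral_nonneg zero_le_one fun t _ => sq_nonneg _
  have hE2y : 0 ≤ ∫ t in (0:ℝ)..1, ((p.v t k).2 - (p.v t l).2) ^ 2 :=
    intervalIntegral.integral_nonneg zero_le_one fun t _ => sq_nonneg _
  set I := ∫ t in (0:ℝ)..1, (√(((p.q t i).1 - (p.q t j).1) ^ 2 +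
      ((p.q t i).2 - (p.q t j).2) ^ 2 + 0.0001 ^ 2))⁻¹ with hI
  set Ex1 := ∫ t in (0:ℝ)..1, ((p.v t i).1 - (p.v t j).1) ^ 2 with hEx1
  set Ey1 := ∫ t in (0:ℝ)..1, ((p.v t i).2 - (p.v t j).2) ^ 2 with hEy1
  set Ex2 := ∫ t in (0:ℝ)..1, ((p.v t k).1 - (p.v t l).1) ^ 2 with hEx2
  set Ey2 := ∫ t in (0:ℝ)..1, ((p.v t k).2 - (p.v t l).2) ^ 2 with hEy2
  set K := 6 * ρ - θ ^ 2 / 8 * (5 * (Ex1 + Ey1) + 2 * (Ex2 + Ey2) + 4 * c ^ 2) with hK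
  have hb1x := bx1 e he
  have hb1y := by1 e he
  have hθ2 : θ ^ 2 / 8 ≤ 0.0037 := by nlinarith
  have hg := (((((((ix1.const_mul (1 / 4)).add (iy1.const_mul (1 / 4))).add
    (ix2.const_mul (1 / 4))).add (iy2.const_mul (1 / 4))).add (iX.const_mul (1 / 2))).add
    (iY.const_mul (1 / 2))).add hinv).add (intervalIntegrable_const (c := K))
  refine le_trans (ENNReal.ofReal_le_ofReal ?_) (p.integral_le_action hρ hpair hsum hg ?_)
  · rw [intervalIntegral.integral_add
        (((((((ix1.const_mul (1 / 4)).add (iy1.const_mul (1 / 4))).add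
        (ix2.const_mul (1 / 4))).add (iy2.const_mul (1 / 4))).add (iX.const_mul (1 / 2))).add
        (iY.const_mul (1 / 2))).add hinv) intervalIntegrable_const,
      intervalIntegral.integral_add
        ((((((ix1.const_mul (1 / 4)).add (iy1.const_mul (1 / 4))).add
        (ix2.const_mul (1 / 4))).add (iy2.const_mul (1 / 4))).add (iX.const_mul (1 / 2))).add
        (iY.const_mul (1 / 2))) hinv,
      intervalIntegral.integral_add
        (((((ix1.const_mul (1 / 4)).add (iy1.const_mul (1 / 4))).add
        (ix2.const_mul (1 / 4))).add (iy2.const_mul (1 / 4))).add (iX.const_mul (1 / 2)))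
        (iY.const_mul (1 / 2)),
      intervalIntegral.integral_add
        ((((ix1.const_mul (1 / 4)).add (iy1.const_mul (1 / 4))).add
        (ix2.const_mul (1 / 4))).add (iy2.const_mul (1 / 4))) (iX.const_mul (1 / 2)),
      intervalIntegral.integral_add
        (((ix1.const_mul (1 / 4)).add (iy1.const_mul (1 / 4))).add
        (ix2.const_mul (1 / 4))) (iy2.const_mul (1 / 4)),
      intervalIntegral.integral_add
        ((ix1.const_mul (1 / 4)).add (iy1.const_mul (1 / 4))) (ix2.const_mul (1 / 4)),
      intervalIntegral.integral_add (ix1.const_mul (1 / 4)) (iy1.const_mul (1 / 4)),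
      intervalIntegral.integral_const_mul, intervalIntegral.integral_const_mul,
      intervalIntegral.integral_const_mul, intervalIntegral.integral_const_mul,
      intervalIntegral.integral_const_mul, intervalIntegral.integral_const_mul,
      intervalIntegral.integral_const, ← hEx1, ← hEy1, ← hEx2, ← hEy2, ← hI]
    have hE1 : 0 ≤ Ex1 + Ey1 := by nlinarith
    have hm := mul_le_mul_of_nonneg_right hθ2
      (show 0 ≤ 5 * (Ex1 + Ey1) + 2 * (Ex2 + Ey2) + 4 * c ^ 2 by positivity)
    simp only [sub_zero, one_smul]
    nlinarith [sq_nonneg c]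
  · intro t ht
    have hbx1 := bx1 t ht
    have hby1 := by1 t ht
    have hbx2 := bx2 t ht
    have hby2 := by2 t ht
    simp only [enorm2_sq, Prod.fst_sub, Prod.snd_sub, hρθ, hK]
    have hm := mul_le_mul_of_nonneg_left
      (show ((p.q t i).1 - (p.q t j).1) ^ 2 + ((p.q t i).2 - (p.q t j).2) ^ 2 +
        ((p.q t k).1 - (p.q t l).1) ^ 2 + ((p.q t k).2 - (p.q t l).2) ^ 2 ≤
        5 * (Ex1 + Ey1) + 2 * (Ex2 + Ey2) + 4 * c ^ 2 by linarith)
      (show 0 ≤ θ ^ 2 / 8 by positivity)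
    have hsq := sq_nonneg ((p.v t i).1 + (p.v t j).1 + (p.v t k).1 + (p.v t l).1)
    have hsq' := sq_nonneg ((p.v t i).2 + (p.v t j).2 + (p.v t k).2 + (p.v t l).2)
    linarith

lemma enorm2_rotV_sub_sq (θ : ℝ) (v w : ℝ × ℝ) :
    enorm2 (rotV θ v - rotV θ w) ^ 2 = (v.1 - w.1) ^ 2 + (v.2 - w.2) ^ 2 := by
  simp only [enorm2_sq, rotV, Prod.fst_sub, Prod.snd_sub]
  linear_combination ((v.1 - w.1) ^ 2 + (v.2 - w.2) ^ 2) * sin_sq_add_cos_sq θ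

/-- Collisions of `{1, 2}`, `{3, 4}`, `{1, 3}` or `{2, 4}`: the centres of mass of the two pairs
start in the second or fourth quadrant and end on the line of angle `θ`. -/
lemma H1Path4.le_action_of_collision_parallel (p : H1Path4) {i j k l : Fin 4} {θ ρ t₀ : ℝ}
    (hρ : 0 < ρ) (hρθ : ρ ^ 3 = θ ^ 2 / 4) (h0 : 0 < θ) (h1 : θ ≤ 0.17)
    (hpair : ∀ f : Fin 4 → Fin 4 → ℝ≥0∞, (∀ a b, f a b = f b a) →
      ∑ a : Fin 4, ∑ b ∈ Finset.univ.filter (fun b => a < b), f a b =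
        f i j + (f k l + (f i k + (f i l + (f j k + f j l)))))
    (hsum : ∀ g : Fin 4 → ℝ, ∑ a, g a = g i + g j + g k + g l)
    (ht₀ : t₀ ∈ Icc (0:ℝ) 1) (hcol : p.q t₀ i = p.q t₀ j)
    (hend : enorm2 (p.q 1 k - p.q 1 l) ^ 2 = enorm2 (p.q 1 i - p.q 1 j) ^ 2)
    (hq : (1 / 2 * ((p.q 0 k).1 + (p.q 0 l).1 - ((p.q 0 i).1 + (p.q 0 j).1))) *
      (1 / 2 * ((p.q 0 k).2 + (p.q 0 l).2 - ((p.q 0 i).2 + (p.q 0 j).2))) ≤ 0)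
    (hl : cos θ * (1 / 2 * ((p.q 1 k).2 + (p.q 1 l).2 - ((p.q 1 i).2 + (p.q 1 j).2))) -
      sin θ * (1 / 2 * ((p.q 1 k).1 + (p.q 1 l).1 - ((p.q 1 i).1 + (p.q 1 j).1))) = 0) :
    ENNReal.ofReal (6 * ρ + 2.4) ≤ action p := by
  refine p.le_action_of_collision (c := 0) (e := 1) hρ hρθ h0 h1 hpair hsum ht₀ hcol (by simp) ?_ ?_
  · rw [hend]
    nlinarith [sq_nonneg (enorm2 (p.q 1 i - p.q 1 j))]
  · have hX := (((p.isH1_fst k).add (p.isH1_fst l)).sub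
      ((p.isH1_fst i).add (p.isH1_fst j))).const_mul (1 / 2)
    have hY := (((p.isH1_snd k).add (p.isH1_snd l)).sub
      ((p.isH1_snd i).add (p.isH1_snd j))).const_mul (1 / 2)
    simpa using hX.lagrangian_nonneg hY h0 h1 hl hq

/-- Collisions of `{1, 4}` or `{2, 3}`: the centres of mass of the two pairs start in the first or
third quadrant and end on the line orthogonal to the one of angle `θ`. -/
lemma H1Path4.le_action_of_collision_orthogonal (p : H1Path4) {i j k l : Fin 4} {θ ρ t₀ c : ℝ}
    (hρ : 0 < ρ) (hρθ : ρ ^ 3 = θ ^ 2 / 4) (h0 : 0 < θ) (h1 : θ ≤ 0.17)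
    (hpair : ∀ f : Fin 4 → Fin 4 → ℝ≥0∞, (∀ a b, f a b = f b a) →
      ∑ a : Fin 4, ∑ b ∈ Finset.univ.filter (fun b => a < b), f a b =
        f i j + (f k l + (f i k + (f i l + (f j k + f j l)))))
    (hsum : ∀ g : Fin 4 → ℝ, ∑ a, g a = g i + g j + g k + g l)
    (ht₀ : t₀ ∈ Icc (0:ℝ) 1) (hcol : p.q t₀ i = p.q t₀ j)
    (hstart : enorm2 (p.q 0 k - p.q 0 l) ^ 2 ≤ 2 * enorm2 (p.q 0 i - p.q 0 j) ^ 2 + 2 * c ^ 2)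
    (hc : (1 / 2 * ((p.q 0 k).1 + (p.q 0 l).1 - ((p.q 0 i).1 + (p.q 0 j).1))) ^ 2 = c ^ 2 / 4)
    (hq : 0 ≤ (1 / 2 * ((p.q 0 k).1 + (p.q 0 l).1 - ((p.q 0 i).1 + (p.q 0 j).1))) *
      (1 / 2 * ((p.q 0 k).2 + (p.q 0 l).2 - ((p.q 0 i).2 + (p.q 0 j).2))))
    (hl : cos θ * (1 / 2 * ((p.q 1 k).1 + (p.q 1 l).1 - ((p.q 1 i).1 + (p.q 1 j).1))) +
      sin θ * (1 / 2 * ((p.q 1 k).2 + (p.q 1 l).2 - ((p.q 1 i).2 + (p.q 1 j).2))) = 0) :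
    ENNReal.ofReal (6 * ρ + 2.4) ≤ action p := by
  refine p.le_action_of_collision (c := c) (e := 0) hρ hρθ h0 h1 hpair hsum ht₀ hcol (by simp)
    hstart ?_
  have hX := (((p.isH1_fst k).add (p.isH1_fst l)).sub
    ((p.isH1_fst i).add (p.isH1_fst j))).const_mul (1 / 2)
  have hY := (((p.isH1_snd k).add (p.isH1_snd l)).sub
    ((p.isH1_snd i).add (p.isH1_snd j))).const_mul (1 / 2)
  have h := hX.sq_le_lagrangian hY h0 h1 hl hq
  rw [hc] at h
  exact le_trans (by linarith) h

lemma H1Path4.le_action_of_inAdm_of_collision (p : H1Path4) {i j : Fin 4} {θ ρ t₀ : ℝ}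
    (hρ : 0 < ρ) (hρθ : ρ ^ 3 = θ ^ 2 / 4) (h0 : 0 < θ) (h1 : θ ≤ 0.17)
    (hp : inAdm (QE1set θ) p) (ht₀ : t₀ ∈ Icc (0:ℝ) 1) (hij : i < j)
    (hcol : p.q t₀ i = p.q t₀ j) :
    ENNReal.ofReal (6 * ρ + 2.4) ≤ action p := by
  obtain ⟨-, ⟨a, b, c, hb, hc, hq0⟩, ⟨a', b', c', -, -, hq1⟩⟩ := hp
  have hbc : 0 ≤ b * c := mul_nonneg hb hc
  have pairs : (i = 0 ∧ j = 1) ∨ (i = 2 ∧ j = 3) ∨ (i = 0 ∧ j = 2) ∨ (i = 1 ∧ j = 3) ∨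
      (i = 0 ∧ j = 3) ∨ (i = 1 ∧ j = 2) := by
    omega
  have swap : ∀ f : Fin 4 → Fin 4 → ℝ≥0∞, (∀ a b, f a b = f b a) →
      f 2 0 = f 0 2 ∧ f 2 1 = f 1 2 ∧ f 3 0 = f 0 3 ∧ f 3 1 = f 1 3 ∧ f 1 0 = f 0 1 ∧
        f 3 2 = f 2 3 := fun f hf => ⟨hf _ _, hf _ _, hf _ _, hf _ _, hf _ _, hf _ _⟩
  rcases pairs with ⟨rfl, rfl⟩ | ⟨rfl, rfl⟩ | ⟨rfl, rfl⟩ | ⟨rfl, rfl⟩ | ⟨rfl, rfl⟩ | ⟨rfl, rfl⟩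
  · refine p.le_action_of_collision_parallel (k := 2) (l := 3) hρ hρθ h0 h1 ?_ ?_ ht₀ hcol ?_ ?_ ?_
    · intro f hf
      obtain ⟨s₂₀, s₂₁, s₃₀, s₃₁, s₁₀, s₃₂⟩ := swap f hf
      simp [Fin.sum_univ_four, Finset.sum_filter, *]
      ring
    · intro g
      simp [Fin.sum_univ_four]
    · simp [hq1, enorm2_rotV_sub_sq]
      ring
    · simp [hq0]
    · simp [hq1, rotV]
      ring
  · refine p.le_action_of_collision_parallel (k := 0) (l := 1) hρ hρθ h0 h1 ?_ ?_ ht₀ hcol ?_ ?_ ?_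
    · intro f hf
      obtain ⟨s₂₀, s₂₁, s₃₀, s₃₁, s₁₀, s₃₂⟩ := swap f hf
      simp [Fin.sum_univ_four, Finset.sum_filter, *]
      ring
    · intro g
      simp [Fin.sum_univ_four]
      ring
    · simp [hq1, enorm2_rotV_sub_sq]
      ring
    · simp [hq0]
    · simp [hq1, rotV]
      ring
  · refine p.le_action_of_collision_parallel (k := 1) (l := 3) hρ hρθ h0 h1 ?_ ?_ ht₀ hcol ?_ ?_ ?_
    · intro f hf
      obtain ⟨s₂₀, s₂₁, s₃₀, s₃₁, s₁₀, s₃₂⟩ := swap f hf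
      simp [Fin.sum_univ_four, Finset.sum_filter, *]
      ring
    · intro g
      simp [Fin.sum_univ_four]
      ring
    · simp [hq1, enorm2_rotV_sub_sq]
      ring
    · simp [hq0]
      nlinarith
    · simp [hq1, rotV]
      ring
  · refine p.le_action_of_collision_parallel (k := 0) (l := 2) hρ hρθ h0 h1 ?_ ?_ ht₀ hcol ?_ ?_ ?_
    · intro f hf
      obtain ⟨s₂₀, s₂₁, s₃₀, s₃₁, s₁₀, s₃₂⟩ := swap f hf
      simp [Fin.sum_univ_four, Finset.sum_filter, *]
      ring
    · intro g
      simp [Fin.sum_univ_four]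
      ring
    · simp [hq1, enorm2_rotV_sub_sq]
      ring
    · simp [hq0]
      nlinarith
    · simp [hq1, rotV]
      ring
  · refine p.le_action_of_collision_orthogonal (k := 1) (l := 2) (c := c) hρ hρθ h0 h1 ?_ ?_ ht₀
      hcol ?_ ?_ ?_ ?_
    · intro f hf
      obtain ⟨s₂₀, s₂₁, s₃₀, s₃₁, s₁₀, s₃₂⟩ := swap f hf
      simp [Fin.sum_univ_four, Finset.sum_filter, *]
      ring
    · intro g
      simp [Fin.sum_univ_four]
      ring
    · simp [hq0, enorm2_sq]
      nlinarith [sq_nonneg (2 * a + 5 * c / 2), sq_nonneg b]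
    · simp [hq0]
      ring
    · simp [hq0]
      nlinarith
    · simp [hq1, rotV]
      ring
  · refine p.le_action_of_collision_orthogonal (k := 0) (l := 3) (c := c) hρ hρθ h0 h1 ?_ ?_ ht₀
      hcol ?_ ?_ ?_ ?_
    · intro f hf
      obtain ⟨s₂₀, s₂₁, s₃₀, s₃₁, s₁₀, s₃₂⟩ := swap f hf
      simp [Fin.sum_univ_four, Finset.sum_filter, *]
      ring
    · intro g
      simp [Fin.sum_univ_four]
      ring
    · simp [hq0, enorm2_sq]
      nlinarith [sq_nonneg (2 * a - c / 2), sq_nonneg b]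
    · simp [hq0]
      ring
    · simp [hq0]
      nlinarith
    · simp [hq1, rotV]
      ring

/-- The superposition of a uniform rotation with frequency `θ` and one with frequency `ψ`. -/
def epicycle (θ ψ α β γ t : ℝ) : ℝ × ℝ :=
  (α * cos (θ * t) + β * cos (ψ * t) + γ * sin (ψ * t),
    α * sin (θ * t) + β * sin (ψ * t) - γ * cos (ψ * t))

/-- The velocity of `epicycle`. -/
def epicycleVel (θ ψ α β γ t : ℝ) : ℝ × ℝ :=
  (-(α * θ * sin (θ * t)) - β * ψ * sin (ψ * t) + γ * ψ * cos (ψ * t),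
    α * θ * cos (θ * t) + β * ψ * cos (ψ * t) + γ * ψ * sin (ψ * t))

lemma hasDerivAt_epicycle (θ ψ α β γ t : ℝ) :
    HasDerivAt (epicycle θ ψ α β γ) (epicycleVel θ ψ α β γ t) t := by
  have hθ : HasDerivAt (fun t => θ * t) θ t := by simpa using (hasDerivAt_id t).const_mul θ
  have hψ : HasDerivAt (fun t => ψ * t) ψ t := by simpa using (hasDerivAt_id t).const_mul ψ
  refine HasDerivAt.prodMk ?_ ?_
  · refine (((hθ.cos.const_mul α).add (hψ.cos.const_mul β)).add
      (hψ.sin.const_mul γ)).congr_deriv ?_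
    ring
  · refine (((hθ.sin.const_mul α).add (hψ.sin.const_mul β)).sub
      (hψ.cos.const_mul γ)).congr_deriv ?_
    ring

lemma continuous_epicycleVel (θ ψ α β γ : ℝ) : Continuous (epicycleVel θ ψ α β γ) := by
  unfold epicycleVel
  fun_prop

lemma continuous_enorm2 : Continuous enorm2 := by
  unfold enorm2
  fun_prop

/-- Two binaries of separation `r`, each rotating with frequency `ψ` and out of phase by a right
angle, whose centres of mass have separation `R` and rotate with frequency `θ`. -/
def binaryPath (R r θ ψ : ℝ) : H1Path4 where
  q t i := epicycle θ ψ (![-R / 2, -R / 2, R / 2, R / 2] i) (![-r / 2, r / 2, 0, 0] i)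
    (![0, 0, -r / 2, r / 2] i) t
  v t i := epicycleVel θ ψ (![-R / 2, -R / 2, R / 2, R / 2] i) (![-r / 2, r / 2, 0, 0] i)
    (![0, 0, -r / 2, r / 2] i) t
  hvInt i := (continuous_epicycleVel _ _ _ _ _).continuousOn.integrableOn_Icc
  hrep i t _ := by
    rw [intervalIntegral.integral_eq_sub_of_hasDerivAt
      (fun s _ => hasDerivAt_epicycle θ ψ _ _ _ s)
      ((continuous_epicycleVel _ _ _ _ _).intervalIntegrable _ _)]
    abel
  hL2 i := ((continuous_enorm2.comp (continuous_epicycleVel _ _ _ _ _)).pow 2).continuousOn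
    |>.integrableOn_Icc

lemma inAdm_binaryPath {R r θ : ℝ} (hr : 0 ≤ r) (hR : r ≤ R) :
    inAdm (QE1set θ) (binaryPath R r θ (θ + π / 4)) := by
  have h2 : √2 ≤ 2 := by rw [Real.sqrt_le_left (by norm_num)]; norm_num
  have h20 : 0 ≤ √2 := Real.sqrt_nonneg 2
  refine ⟨fun t _ => ?_, ⟨R / 2 - r / 2, r / 2, r, by positivity, hr, ?_⟩,
    ⟨r * √2 / 4, R / 2 + r * √2 / 4, R / 2 - r * √2 / 4, by nlinarith, by nlinarith, ?_⟩⟩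
  · simp only [binaryPath, epicycle, Fin.sum_univ_four]
    ext <;> simp <;> ring
  · funext i
    fin_cases i <;> ext <;> simp [binaryPath, epicycle] <;> ring
  · funext i
    fin_cases i <;> simp [binaryPath, epicycle, rotV, cos_add, sin_add] <;> constructor <;> ring

lemma inv_ofReal_add_inv_ofReal_le {ρ d d' A B : ℝ} (hρ : 0 < ρ) (hρ1 : ρ ≤ 0.1932)
    (hd : 0 ≤ d) (hd' : 0 ≤ d') (hdA : d ^ 2 = A + B) (hdA' : d' ^ 2 = A - B)
    (hA : ρ ^ 2 * A = 1 + 0.845 * ρ ^ 2) (hB : (ρ * B) ^ 2 ≤ 3.38) :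
    (ENNReal.ofReal d)⁻¹ + (ENNReal.ofReal d')⁻¹ ≤ ENNReal.ofReal (2 * ρ + 0.022) := by
  have hρ2 : ρ ^ 2 ≤ 0.03733 := by nlinarith
  have hprod : (ρ * d) ^ 2 * (ρ * d') ^ 2 = (ρ ^ 2 * A) ^ 2 - ρ ^ 2 * (ρ * B) ^ 2 := by
    rw [mul_pow, mul_pow, hdA, hdA']
    ring
  have hsum : (ρ * d) ^ 2 + (ρ * d') ^ 2 = 2 * (ρ ^ 2 * A) := by
    rw [mul_pow, mul_pow, hdA, hdA']
    ring
  rw [hA] at hprod hsum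
  have hprod' : 1 - 1.69 * ρ ^ 2 ≤ (ρ * d) ^ 2 * (ρ * d') ^ 2 := by
    rw [hprod]
    nlinarith [mul_le_mul_of_nonneg_left hB (sq_nonneg ρ)]
  have hprod0 : 0 < (ρ * d) ^ 2 * (ρ * d') ^ 2 := by nlinarith
  have hx : 0 < ρ * d := lt_of_le_of_ne (by positivity) fun h => by
    rw [← h] at hprod0
    simp at hprod0
  have hy : 0 < ρ * d' := lt_of_le_of_ne (by positivity) fun h => by
    rw [← h] at hprod0
    simp at hprod0
  have hd0 : 0 < d := pos_of_mul_pos_right hx hρ.le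
  have hd0' : 0 < d' := pos_of_mul_pos_right hy hρ.le
  rw [← ENNReal.ofReal_inv_of_pos hd0, ← ENNReal.ofReal_inv_of_pos hd0',
    ← ENNReal.ofReal_add (by positivity) (by positivity)]
  refine ENNReal.ofReal_le_ofReal ?_
  have key : ∀ x : ℝ, 0 < x → x⁻¹ ≤ 1 / 2 + 1 / 2 * (x ^ 2)⁻¹ := fun x hx => by
    have : (x ^ 2)⁻¹ = x⁻¹ ^ 2 := by rw [inv_pow]
    rw [this]
    nlinarith [sq_nonneg (x⁻¹ - 1)]
  have hsplit : d⁻¹ + d'⁻¹ = ρ * ((ρ * d)⁻¹ + (ρ * d')⁻¹) := by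
    field_simp
  have hrat : ((ρ * d) ^ 2)⁻¹ + ((ρ * d') ^ 2)⁻¹ ≤ 2 + 0.22 := by
    rw [inv_add_inv (by positivity) (by positivity), hsum, div_le_iff₀ hprod0]
    nlinarith
  rw [hsplit]
  nlinarith [key _ hx, key _ hy]

lemma action_binaryPath_le {ρ θ : ℝ} (hρ : 0 < ρ) (hρ1 : ρ ≤ 0.1932) (hρθ : ρ ^ 3 = θ ^ 2 / 4)
    (h0 : 0 < θ) (h1 : θ ≤ 0.0539 * π) :
    action (binaryPath (1 / ρ) 1.3 θ (θ + π / 4)) ≤ ENNReal.ofReal (6 * ρ + 2.36) := by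
  set P := binaryPath (1 / ρ) 1.3 θ (θ + π / 4) with hP
  have hψ : (θ + π / 4) ^ 2 ≤ 0.912 := by
    have : θ + π / 4 ≤ 0.9548 := by linarith [pi_lt_d4]
    have : 0 ≤ θ + π / 4 := by positivity
    nlinarith
  have hpt : ∀ t ∈ Icc (0:ℝ) 1,
      (ENNReal.ofReal ((1/2) * ∑ i, enorm2 (P.v t i) ^ 2)
      + ∑ i : Fin 4, ∑ j ∈ Finset.univ.filter (fun j => i < j),
          (ENNReal.ofReal (enorm2 (P.q t i - P.q t j)))⁻¹) ≤ ENNReal.ofReal (6 * ρ + 2.36) := by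
    intro t _
    have hθ1 := sin_sq_add_cos_sq (θ * t)
    have hψ1 := sin_sq_add_cos_sq ((θ + π / 4) * t)
    have hkin : 1 / 2 * ∑ i, enorm2 (P.v t i) ^ 2 =
        2 * ρ + 0.845 * (θ + π / 4) ^ 2 := by
      have hR : 1 / 2 * (1 / ρ) ^ 2 * θ ^ 2 = 2 * ρ := by
        field_simp
        linarith
      simp only [hP, binaryPath, epicycleVel, enorm2_sq, Fin.sum_univ_four, Matrix.cons_val]
      linear_combination hR + 1 / 2 * (1 / ρ) ^ 2 * θ ^ 2 * hθ1 +
        0.845 * (θ + π / 4) ^ 2 * hψ1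
    have h01 : enorm2 (P.q t 0 - P.q t 1) = 1.3 := by
      refine (pow_left_inj₀ (enorm2_nonneg _) (by norm_num) two_ne_zero).1 ?_
      simp only [hP, binaryPath, epicycle, enorm2_sq, Prod.fst_sub, Prod.snd_sub, Matrix.cons_val]
      linear_combination 1.69 * hψ1
    have h23 : enorm2 (P.q t 2 - P.q t 3) = 1.3 := by
      refine (pow_left_inj₀ (enorm2_nonneg _) (by norm_num) two_ne_zero).1 ?_
      simp only [hP, binaryPath, epicycle, enorm2_sq, Prod.fst_sub, Prod.snd_sub, Matrix.cons_val]
      linear_combination 1.69 * hψ1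
    set A := 1 / ρ ^ 2 + 0.845 with hA
    set φ := (θ + π / 4) * t - θ * t with hφ
    have hcos : cos φ = cos ((θ + π / 4) * t) * cos (θ * t) +
      sin ((θ + π / 4) * t) * sin (θ * t) := cos_sub _ _
    have hsin : sin φ = sin ((θ + π / 4) * t) * cos (θ * t) -
      cos ((θ + π / 4) * t) * sin (θ * t) := sin_sub _ _
    have h02 : enorm2 (P.q t 0 - P.q t 2) ^ 2 = A + 1.3 / ρ * (cos φ - sin φ) := by
      rw [hcos, hsin, hA]
      simp only [hP, binaryPath, epicycle, enorm2_sq, Prod.fst_sub, Prod.snd_sub, Matrix.cons_val]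
      linear_combination (1 / ρ) ^ 2 * hθ1 + 0.845 * hψ1
    have h13 : enorm2 (P.q t 1 - P.q t 3) ^ 2 = A - 1.3 / ρ * (cos φ - sin φ) := by
      rw [hcos, hsin, hA]
      simp only [hP, binaryPath, epicycle, enorm2_sq, Prod.fst_sub, Prod.snd_sub, Matrix.cons_val]
      linear_combination (1 / ρ) ^ 2 * hθ1 + 0.845 * hψ1
    have h03 : enorm2 (P.q t 0 - P.q t 3) ^ 2 = A + 1.3 / ρ * (cos φ + sin φ) := by
      rw [hcos, hsin, hA]
      simp only [hP, binaryPath, epicycle, enorm2_sq, Prod.fst_sub, Prod.snd_sub, Matrix.cons_val]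
      linear_combination (1 / ρ) ^ 2 * hθ1 + 0.845 * hψ1
    have h12 : enorm2 (P.q t 1 - P.q t 2) ^ 2 = A - 1.3 / ρ * (cos φ + sin φ) := by
      rw [hcos, hsin, hA]
      simp only [hP, binaryPath, epicycle, enorm2_sq, Prod.fst_sub, Prod.snd_sub, Matrix.cons_val]
      linear_combination (1 / ρ) ^ 2 * hθ1 + 0.845 * hψ1
    have hA' : ρ ^ 2 * A = 1 + 0.845 * ρ ^ 2 := by
      rw [hA]
      field_simp
    have hone := sin_sq_add_cos_sq φ
    have hB₁ : (ρ * (1.3 / ρ * (cos φ - sin φ))) ^ 2 ≤ 3.38 := by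
      rw [← mul_assoc, mul_div_cancel₀ _ hρ.ne']
      nlinarith [sq_nonneg (cos φ + sin φ)]
    have hB₂ : (ρ * (1.3 / ρ * (cos φ + sin φ))) ^ 2 ≤ 3.38 := by
      rw [← mul_assoc, mul_div_cancel₀ _ hρ.ne']
      nlinarith [sq_nonneg (cos φ - sin φ)]
    have e₁ := inv_ofReal_add_inv_ofReal_le hρ hρ1 (enorm2_nonneg _) (enorm2_nonneg _) h02 h13
      hA' hB₁
    have e₂ := inv_ofReal_add_inv_ofReal_le hρ hρ1 (enorm2_nonneg _) (enorm2_nonneg _) h03 h12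
      hA' hB₂
    have hpairs : ∑ i : Fin 4, ∑ j ∈ Finset.univ.filter (fun j => i < j),
          (ENNReal.ofReal (enorm2 (P.q t i - P.q t j)))⁻¹ =
        ENNReal.ofReal (1.3)⁻¹ + ENNReal.ofReal (1.3)⁻¹ +
        (((ENNReal.ofReal (enorm2 (P.q t 0 - P.q t 2)))⁻¹ +
          (ENNReal.ofReal (enorm2 (P.q t 1 - P.q t 3)))⁻¹) +
        ((ENNReal.ofReal (enorm2 (P.q t 0 - P.q t 3)))⁻¹ +
          (ENNReal.ofReal (enorm2 (P.q t 1 - P.q t 2)))⁻¹)) := by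
      rw [ENNReal.ofReal_inv_of_pos (by norm_num)]
      nth_rewrite 1 [← h01]
      rw [← h23]
      simp [Fin.sum_univ_four, Finset.sum_filter]
      ring
    rw [hpairs, hkin]
    refine (add_le_add_right (add_le_add_right (add_le_add e₁ e₂) _) _).trans ?_
    rw [← ENNReal.ofReal_add (by norm_num) (by norm_num),
      ← ENNReal.ofReal_add (by positivity) (by positivity),
      ← ENNReal.ofReal_add (by norm_num) (by positivity),
      ← ENNReal.ofReal_add (by positivity) (by positivity)]
    refine ENNReal.ofReal_le_ofReal ?_
    norm_num at hψ ⊢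
    linarith
  refine (setLIntegral_mono' measurableSet_Icc hpt).trans ?_
  simp

/-- For `0 < θ ≤ 0.0539·π`, every action minimizer of `A` over
`P(Q_S, Q_{E₁})` is collision-free on `[0,1]`. -/
theorem statement0 (θ : ℝ) (hθ0 : 0 < θ) (hθ1 : θ ≤ 0.0539 * π)
    (p : H1Path4) (hp : isMin (QE1set θ) p) :
    ∀ t ∈ Icc (0:ℝ) 1, ∀ i j : Fin 4, i ≠ j → p.q t i ≠ p.q t j := by
  intro t ht i j hij hcol
  wlog hlt : i < j generalizing i j
  · exact this j i hij.symm hcol.symm (lt_of_le_of_ne (not_lt.1 hlt) hij.symm)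
  have hθ : θ ≤ 0.1694 := by linarith [pi_lt_d4]
  obtain ⟨ρ, hρ, hρθ⟩ : ∃ ρ : ℝ, 0 < ρ ∧ ρ ^ 3 = θ ^ 2 / 4 := by
    refine ⟨(θ ^ 2 / 4) ^ ((3 : ℕ) : ℝ)⁻¹, by positivity, ?_⟩
    exact Real.rpow_inv_natCast_pow (by positivity) (by norm_num)
  have hρ1 : ρ ≤ 0.1932 := by
    refine le_of_pow_le_pow_left₀ (n := 3) (by norm_num) (by norm_num) ?_
    rw [hρθ]
    nlinarith
  have hR : 1.3 ≤ 1 / ρ := by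
    rw [le_div_iff₀ hρ]
    linarith
  have hlow := p.le_action_of_inAdm_of_collision hρ hρθ hθ0 (by linarith) hp.1 ht hlt hcol
  have hup := action_binaryPath_le hρ hρ1 hρθ hθ0 hθ1
  have hmin := hp.2 _ (inAdm_binaryPath (θ := θ) (by norm_num) hR)
  have h := (ENNReal.ofReal_le_ofReal_iff (by positivity)).1 (hlow.trans (hmin.trans hup))
  norm_num at h

end
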